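/- Let n ≥ 1, let Ω = I_n ⊗ [[0,1],[-1,0]], let S₀ be a real symplectic 2n×2n matrix, let ν₁,…,ν_n be reals with each ν_j > 1, let D₀ := diag(ν₁,…,ν_n) ⊗ I₂, E₀ := diag(√(1-ν₁⁻²),…,√(1-ν_n⁻²)) ⊗ I₂, V₀ := S₀ᵀD₀S₀ and R₀ := S₀ᵀ E₀ S₀⁻ᵀ. Let V₅ be a real symmetric 2n×2n matrix such that the complex Hermitian matrix V₅ + iΩ is positive definite. Define the real symmetric matrix V₆ := V₀ − R₀ V₀ (V₅ + V₀)⁻¹ V₀ R₀ᵀ. Then the complex Hermitian matrix V₆ − iΩ is positive definite. -/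

import Mathlib

open Matrix
open scoped Kronecker ComplexOrder

noncomputable section

/-- The `2n × 2n` standard symplectic form `Ω = I_n ⊗ [[0,1],[-1,0]]`. -/
def Omega (n : ℕ) : Matrix (Fin n × Fin 2) (Fin n × Fin 2) ℝ :=
  (1 : Matrix (Fin n) (Fin n) ℝ) ⊗ₖ !![(0 : ℝ), 1; -1, 0]

/-- Complexification of a real `2n × 2n` matrix. -/
def cmat {n : ℕ} (M : Matrix (Fin n × Fin 2) (Fin n × Fin 2) ℝ) :
    Matrix (Fin n × Fin 2) (Fin n × Fin 2) ℂ :=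
  M.map Complex.ofReal

/-- Strict antitonicity of the matrix inverse, in additive form. -/
lemma posDef_inv_sub_inv_add {m : Type*} [Fintype m] [DecidableEq m]
    {Q N : Matrix m m ℂ} (hQ : Q.PosDef) (hN : N.PosDef) :
    (Q⁻¹ - (Q + N)⁻¹).PosDef := by
  have hP : (Q + N).PosDef := hQ.add hN
  have hPu : IsUnit (Q + N).det := (isUnit_iff_isUnit_det _).1 hP.isUnit
  have hQu : IsUnit Q.det := (isUnit_iff_isUnit_det _).1 hQ.isUnit
  have hK : (N + N * Q⁻¹ * N).PosDef := by
    refine hN.add_posSemidef ?_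
    have h := hQ.inv.posSemidef.conjTranspose_mul_mul_same N
    rwa [hN.isHermitian.eq] at h
  have hPinv := hP.inv
  have h := hK.conjTranspose_mul_mul_same (B := (Q + N)⁻¹)
    (mulVec_injective_of_isUnit hPinv.isUnit)
  rw [hPinv.isHermitian.eq] at h
  convert h using 1
  have e : N + N * Q⁻¹ * N = (Q + N) * Q⁻¹ * (Q + N) - (Q + N) := by
    simp only [add_mul, mul_add, mul_nonsing_inv _ hQu, one_mul, mul_assoc,
      nonsing_inv_mul _ hQu, mul_one]
    abel
  rw [e, mul_sub, sub_mul, nonsing_inv_mul _ hPu, one_mul, ← mul_assoc, ← mul_assoc,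
    nonsing_inv_mul _ hPu, one_mul, mul_assoc, mul_nonsing_inv _ hPu, mul_one]

section cmat

variable {n : ℕ} (M N : Matrix (Fin n × Fin 2) (Fin n × Fin 2) ℝ)

lemma cmat_mul : cmat (M * N) = cmat M * cmat N :=
  Matrix.map_mul (f := Complex.ofRealHom)

lemma cmat_add : cmat (M + N) = cmat M + cmat N :=
  Matrix.map_add _ Complex.ofReal_add M N

lemma cmat_sub : cmat (M - N) = cmat M - cmat N :=
  Matrix.map_sub _ Complex.ofReal_sub M N

lemma cmat_neg : cmat (-M) = -cmat M := by
  ext; simp [cmat]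

lemma cmat_one : cmat (1 : Matrix (Fin n × Fin 2) (Fin n × Fin 2) ℝ) = 1 :=
  Matrix.map_one _ Complex.ofReal_zero Complex.ofReal_one

lemma cmat_transpose : cmat Mᵀ = (cmat M)ᵀ := rfl

lemma cmat_conjTranspose : (cmat M)ᴴ = cmat Mᵀ := by
  ext; simp [cmat]

lemma cmat_inv_of_isUnit {P : Matrix (Fin n × Fin 2) (Fin n × Fin 2) ℝ} (hP : IsUnit P.det) :
    cmat P⁻¹ = (cmat P)⁻¹ := by
  symm
  apply inv_eq_left_inv
  rw [← cmat_mul, nonsing_inv_mul _ hP, cmat_one]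

lemma isUnit_det_of_cmat (h : IsUnit (cmat M)) : IsUnit M.det := by
  rw [isUnit_iff_isUnit_det] at h
  have e : (cmat M).det = (M.det : ℂ) := (Complex.ofRealHom.map_det M).symm
  rw [e, isUnit_iff_ne_zero] at h
  rw [isUnit_iff_ne_zero]
  exact_mod_cast h

end cmat

lemma Omega_mul_self (n : ℕ) : Omega n * Omega n = -1 := by
  have h : !![(0 : ℝ), 1; -1, 0] * !![(0 : ℝ), 1; -1, 0] = (-1 : ℝ) • 1 := by
    ext i j; fin_cases i <;> fin_cases j <;> simp
  rw [Omega, ← mul_kronecker_mul, h, mul_one, kronecker_smul, one_kronecker_one, neg_one_smul]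

lemma Omega_transpose (n : ℕ) : (Omega n)ᵀ = -Omega n := by
  have h : !![(0 : ℝ), 1; -1, 0]ᵀ = (-1 : ℝ) • !![(0 : ℝ), 1; -1, 0] := by
    ext i j; fin_cases i <;> fin_cases j <;> simp
  rw [Omega, ← kroneckerMap_transpose, h, transpose_one, kronecker_smul, neg_one_smul]

lemma Omega_commute_diagonal {n : ℕ} (d : Fin n → ℝ) :
    Omega n * (diagonal d ⊗ₖ (1 : Matrix (Fin 2) (Fin 2) ℝ)) =
      (diagonal d ⊗ₖ (1 : Matrix (Fin 2) (Fin 2) ℝ)) * Omega n := by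
  rw [Omega, ← mul_kronecker_mul, ← mul_kronecker_mul, one_mul, mul_one, one_mul, mul_one]

lemma I_smul_Omega_mul_self (n : ℕ) :
    (Complex.I • cmat (Omega n)) * (Complex.I • cmat (Omega n)) = 1 := by
  rw [smul_mul_smul_comm, Complex.I_mul_I, ← cmat_mul, Omega_mul_self, cmat_neg, cmat_one]
  simp

lemma I_smul_Omega_isHermitian (n : ℕ) : (Complex.I • cmat (Omega n)).IsHermitian := by
  rw [IsHermitian, conjTranspose_smul, cmat_conjTranspose, Omega_transpose, cmat_neg]
  simp

lemma posDef_cmat_diagonal_add_I_smul_Omega {n : ℕ} {ν : Fin n → ℝ} (hν : ∀ j, 1 < ν j) :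
    (cmat (diagonal ν ⊗ₖ (1 : Matrix (Fin 2) (Fin 2) ℝ)) + Complex.I • cmat (Omega n)).PosDef := by
  set J := Complex.I • cmat (Omega n) with hJ
  have h1 : (cmat (diagonal ν ⊗ₖ (1 : Matrix (Fin 2) (Fin 2) ℝ)) - 1).PosDef := by
    have e : cmat (diagonal ν ⊗ₖ (1 : Matrix (Fin 2) (Fin 2) ℝ)) - 1 =
        diagonal fun p : Fin n × Fin 2 => ((ν p.1 - 1 : ℝ) : ℂ) := by
      rw [← diagonal_one (n := Fin 2), diagonal_kronecker_diagonal, ← cmat_one, ← cmat_sub,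
        ← diagonal_one, diagonal_sub, cmat, diagonal_map Complex.ofReal_zero]
      simp
    rw [e]
    refine PosDef.diagonal fun p => ?_
    exact_mod_cast sub_pos.2 (hν p.1)
  have h2 : (1 + J).PosSemidef := by
    have h := (posSemidef_conjTranspose_mul_self (1 + J)).smul
      (show (0 : ℝ) ≤ 1 / 2 by norm_num)
    have e : (1 / 2 : ℝ) • ((1 + J)ᴴ * (1 + J)) = 1 + J := by
      rw [conjTranspose_add, conjTranspose_one, (I_smul_Omega_isHermitian n).eq, ← hJ,
        add_mul, mul_add, mul_add, I_smul_Omega_mul_self, one_mul, mul_one, one_mul]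
      module
    rwa [e] at h
  convert h1.add_posSemidef h2 using 1
  abel

/-- With `V₀ = S₀ᵀD₀S₀` in Williamson form, `R₀ = √(I + (V₀Ω)⁻²)`, and `V₅` real
symmetric with `V₅ + iΩ` positive definite, the matrix
`V₆ := V₀ − R₀ V₀ (V₅ + V₀)⁻¹ V₀ R₀ᵀ` satisfies `V₆ − iΩ > 0`. -/
theorem V6_sub_iOmega_posDef (n : ℕ) (hn : 1 ≤ n)
    (S₀ : Matrix (Fin n × Fin 2) (Fin n × Fin 2) ℝ)
    (hS₀ : S₀ᵀ * Omega n * S₀ = Omega n)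
    (ν : Fin n → ℝ) (hν : ∀ j, 1 < ν j)
    (D₀ E₀ V₀ R₀ : Matrix (Fin n × Fin 2) (Fin n × Fin 2) ℝ)
    (hD₀ : D₀ = (Matrix.diagonal ν) ⊗ₖ (1 : Matrix (Fin 2) (Fin 2) ℝ))
    (hE₀ : E₀ = (Matrix.diagonal fun j => Real.sqrt (1 - ((ν j) ^ 2)⁻¹)) ⊗ₖ
      (1 : Matrix (Fin 2) (Fin 2) ℝ))
    (hV₀ : V₀ = S₀ᵀ * D₀ * S₀)
    (hR₀ : R₀ = S₀ᵀ * E₀ * (S₀⁻¹)ᵀ)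
    (V₅ : Matrix (Fin n × Fin 2) (Fin n × Fin 2) ℝ) (hV₅symm : V₅.IsSymm)
    (hV₅ : (cmat V₅ + Complex.I • cmat (Omega n)).PosDef)
    (V₆ : Matrix (Fin n × Fin 2) (Fin n × Fin 2) ℝ)
    (hV₆ : V₆ = V₀ - R₀ * V₀ * (V₅ + V₀)⁻¹ * V₀ * R₀ᵀ) :
    (cmat V₆ - Complex.I • cmat (Omega n)).PosDef := by
  have hSl : -(Omega n) * S₀ᵀ * Omega n * S₀ = 1 := by
    rw [mul_assoc, mul_assoc, ← mul_assoc S₀ᵀ, hS₀, neg_mul, Omega_mul_self, neg_neg]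
  have hSu : IsUnit S₀.det := isUnit_det_of_left_inverse hSl
  have hSinj : Function.Injective (cmat S₀).mulVec := by
    apply mulVec_injective_of_isUnit
    refine IsUnit.of_mul_eq_one (cmat S₀⁻¹) ?_
    rw [← cmat_mul, mul_nonsing_inv _ hSu, cmat_one]
  set F : Matrix (Fin n × Fin 2) (Fin n × Fin 2) ℝ :=
    diagonal (fun j => Real.sqrt (1 - ((ν j) ^ 2)⁻¹) * ν j) ⊗ₖ
      (1 : Matrix (Fin 2) (Fin 2) ℝ) with hF
  have hED : E₀ * D₀ = F := by
    rw [hE₀, hD₀, ← mul_kronecker_mul, diagonal_mul_diagonal, one_mul]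
  have hDt : D₀ᵀ = D₀ := by
    rw [hD₀, ← kroneckerMap_transpose, diagonal_transpose, transpose_one]
  have hFt : Fᵀ = F := by
    rw [hF, ← kroneckerMap_transpose, diagonal_transpose, transpose_one]
  have hFD : F * D₀ = D₀ * F := by
    rw [hF, hD₀, ← mul_kronecker_mul, ← mul_kronecker_mul, diagonal_mul_diagonal,
      diagonal_mul_diagonal]
    simp only [mul_comm]
  have hFF : F * F = D₀ * D₀ - 1 := by
    have e : (fun j => Real.sqrt (1 - ((ν j) ^ 2)⁻¹) * ν j * (Real.sqrt (1 - ((ν j) ^ 2)⁻¹) * ν j))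
        = fun j => ν j * ν j - 1 := by
      funext j
      have hj := hν j
      have h0 : 0 ≤ 1 - ((ν j) ^ 2)⁻¹ :=
        sub_nonneg.2 (inv_le_one_of_one_le₀ (by nlinarith))
      rw [mul_mul_mul_comm, Real.mul_self_sqrt h0]
      field_simp
    rw [hF, hD₀, ← mul_kronecker_mul, ← mul_kronecker_mul, diagonal_mul_diagonal,
      diagonal_mul_diagonal, e, ← one_kronecker_one, ← diagonal_one (n := Fin n),
      sub_eq_add_neg, ← neg_one_smul ℝ (_ ⊗ₖ _), ← smul_kronecker]
    rw [one_mul, ← add_kronecker]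
    congr 1
    ext i j
    by_cases h : i = j <;> simp [h, sub_eq_add_neg]
  set J := Complex.I • cmat (Omega n) with hJ
  have hJF : cmat F * J = J * cmat F := by
    rw [hJ, mul_smul_comm, smul_mul_assoc, ← cmat_mul, ← cmat_mul, hF, Omega_commute_diagonal]
  have hJD : cmat D₀ * J = J * cmat D₀ := by
    rw [hJ, mul_smul_comm, smul_mul_assoc, ← cmat_mul, ← cmat_mul, hD₀, Omega_commute_diagonal]
  have hJJ : J * J = 1 := I_smul_Omega_mul_self n
  have hSJ : (cmat S₀)ᴴ * J * cmat S₀ = J := by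
    rw [cmat_conjTranspose, hJ, mul_smul_comm, smul_mul_assoc, ← cmat_mul, ← cmat_mul, hS₀]
  have hQd : (cmat D₀ + J).PosDef := hD₀ ▸ posDef_cmat_diagonal_add_I_smul_Omega hν
  have hQdu : IsUnit (cmat D₀ + J).det := (isUnit_iff_isUnit_det _).1 hQd.isUnit
  have hQeq : cmat V₀ + J = (cmat S₀)ᴴ * (cmat D₀ + J) * cmat S₀ := by
    rw [mul_add, add_mul, hSJ, cmat_conjTranspose, ← cmat_mul, ← cmat_mul, hV₀]
  have hAeq : cmat V₀ - J = (cmat S₀)ᴴ * (cmat D₀ - J) * cmat S₀ := by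
    rw [mul_sub, sub_mul, hSJ, cmat_conjTranspose, ← cmat_mul, ← cmat_mul, hV₀]
  have hQ : (cmat V₀ + J).PosDef := by
    rw [hQeq]; exact hQd.conjTranspose_mul_mul_same hSinj
  have hJt : Jᵀ = -J := by
    rw [hJ, transpose_smul, ← cmat_transpose, Omega_transpose, cmat_neg, smul_neg]
  have hN : (cmat V₅ - J).PosDef := by
    have h := hV₅.transpose
    rw [transpose_add, ← cmat_transpose, hV₅symm.eq, hJt, ← sub_eq_add_neg] at h
    exact h
  have hsum : cmat V₀ + J + (cmat V₅ - J) = cmat (V₅ + V₀) := by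
    rw [cmat_add]; abel
  have hPu : IsUnit (V₅ + V₀).det :=
    isUnit_det_of_cmat _ (hsum ▸ (hQ.add hN).isUnit)
  have hRV : R₀ * V₀ = S₀ᵀ * F * S₀ := by
    have hSt : (S₀⁻¹)ᵀ * S₀ᵀ = 1 := by
      rw [← transpose_mul, mul_nonsing_inv _ hSu, transpose_one]
    rw [hR₀, hV₀, ← hED]
    simp only [mul_assoc]
    rw [← mul_assoc (S₀⁻¹)ᵀ, hSt, one_mul]
  have hV₀t : V₀ᵀ = V₀ := by
    simp only [hV₀, transpose_mul, transpose_transpose, hDt, mul_assoc]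
  have hRVt : V₀ * R₀ᵀ = R₀ * V₀ := by
    have : V₀ * R₀ᵀ = (R₀ * V₀)ᵀ := by rw [transpose_mul, hV₀t]
    rw [this, hRV]
    simp only [transpose_mul, transpose_transpose, hFt, mul_assoc]
  have hBt : (cmat (R₀ * V₀))ᴴ = cmat (R₀ * V₀) := by
    rw [cmat_conjTranspose, transpose_mul, hV₀t, hRVt]
  have hFQ : cmat F * (cmat D₀ + J)⁻¹ * cmat F = cmat D₀ - J := by
    have hc : cmat F * (cmat D₀ + J) = (cmat D₀ + J) * cmat F := by
      rw [mul_add, add_mul, hJF, ← cmat_mul, hFD, cmat_mul]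
    have hc' : cmat F * (cmat D₀ + J)⁻¹ = (cmat D₀ + J)⁻¹ * cmat F := by
      calc cmat F * (cmat D₀ + J)⁻¹
          = (cmat D₀ + J)⁻¹ * ((cmat D₀ + J) * cmat F) * (cmat D₀ + J)⁻¹ := by
            rw [← mul_assoc, nonsing_inv_mul _ hQdu, one_mul]
        _ = (cmat D₀ + J)⁻¹ * cmat F := by
            rw [← hc, mul_assoc, mul_assoc, mul_nonsing_inv _ hQdu, mul_one]
    have hprod : cmat F * cmat F = (cmat D₀ + J) * (cmat D₀ - J) := by
      rw [← cmat_mul, hFF, cmat_sub, cmat_mul, cmat_one, add_mul, mul_sub, mul_sub, hJJ, hJD]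
      abel
    rw [hc', mul_assoc, hprod, ← mul_assoc, nonsing_inv_mul _ hQdu, one_mul]
  have hBQ : cmat (R₀ * V₀) * (cmat V₀ + J)⁻¹ * cmat (R₀ * V₀) = cmat V₀ - J := by
    have hB : cmat (R₀ * V₀) = (cmat S₀)ᴴ * cmat F * cmat S₀ := by
      rw [hRV, cmat_mul, cmat_mul, cmat_conjTranspose]
    have hSc : IsUnit (cmat S₀).det :=
      (isUnit_iff_isUnit_det _).1 (mulVec_injective_iff_isUnit.1 hSinj)
    have hSh : IsUnit (cmat S₀)ᴴ.det := by
      rw [det_conjTranspose]; exact hSc.star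
    rw [hB, hQeq, hAeq, Matrix.mul_inv_rev, Matrix.mul_inv_rev, ← hFQ]
    simp only [mul_assoc]
    rw [← mul_assoc (cmat S₀) (cmat S₀)⁻¹, mul_nonsing_inv _ hSc, one_mul,
      ← mul_assoc (cmat S₀)ᴴ⁻¹, nonsing_inv_mul _ hSh, one_mul]
  have hBinj : Function.Injective (cmat (R₀ * V₀)).mulVec := by
    have hA : (cmat V₀ - J).PosDef := by
      have h := hQ.transpose
      rwa [transpose_add, ← cmat_transpose, hV₀t, hJt, ← sub_eq_add_neg] at h
    have hA' := (isUnit_iff_isUnit_det _).1 hA.isUnit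
    rw [← hBQ, det_mul] at hA'
    exact mulVec_injective_of_isUnit
      ((isUnit_iff_isUnit_det _).2 (isUnit_of_mul_isUnit_right hA'))
  have h := (posDef_inv_sub_inv_add hQ hN).conjTranspose_mul_mul_same hBinj
  rw [hBt, hsum, mul_sub, sub_mul, hBQ, ← cmat_inv_of_isUnit hPu, ← cmat_mul, ← cmat_mul] at h
  rw [hV₆, mul_assoc _ V₀ R₀ᵀ, hRVt, cmat_sub]
  convert h using 1
  abel

end
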